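/- Let l₁, l₂, l₃, l₄ be four distinct lines in Pic S₈ that pairwise intersect in 1, forming an uncornered A₃⁸(1)-polytope with center D = l₁ + l₂ + l₃ + l₄. Then for each 3-element subset {i,j,k} of {1,2,3,4} there exist lines l_a^{ijk}, l_b^{ijk} with l_a^{ijk}·l_b^{ijk} = 0 and l_a^{ijk} + l_b^{ijk} = lᵢ + lⱼ + l_k + K, each satisfying l_a^{ijk}·l_s = l_b^{ijk}·l_s = 0 for s ∈ {i,j,k} and l_a^{ijk}·l_t = l_b^{ijk}·l_t = 1 for the remaining index t; moreover the resulting eight lines are distinct, pairwise intersect in 0, and their sum equals 3D + 4K. -/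

import Mathlib

/-!
Picard lattice of the degree 1 del Pezzo surface S₈:
Pic S₈ = ℤh ⊕ ℤe₁ ⊕ ⋯ ⊕ ℤe₈ ≅ ℤ⁹, with intersection pairing
h·h = 1, h·eᵢ = 0, eᵢ·eⱼ = −δᵢⱼ, and canonical class K = −3h + e₁ + ⋯ + e₈.
-/

namespace DelPezzo

/-- The Picard lattice `Pic S₈ ≅ ℤ⁹`; coordinate `0` is the `h`-coordinate and
coordinates `1,…,8` are the `e₁,…,e₈`-coordinates. -/
abbrev Pic : Type := Fin 9 → ℤ

/-- The intersection pairing on `Pic S₈` (signature `(1,-8)`). -/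
def inter (x y : Pic) : ℤ := x 0 * y 0 - ∑ i : Fin 8, x i.succ * y i.succ

/-- The canonical class `K = -3h + e₁ + ⋯ + e₈`. -/
def K : Pic := fun i => if i = 0 then -3 else 1

/-- A line: a class `l` with `l·l = -1` and `l·K = -1`. -/
def IsLine (l : Pic) : Prop := inter l l = -1 ∧ inter l K = -1

lemma inter_comm (x y : Pic) : inter x y = inter y x := by
  simp only [inter, mul_comm]

lemma inter_add_left (x y z : Pic) : inter (x + y) z = inter x z + inter y z := by
  simp only [inter, Pi.add_apply, add_mul, Finset.sum_add_distrib]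
  ring

lemma inter_smul_left (n : ℤ) (x z : Pic) : inter (n • x) z = n * inter x z := by
  simp only [inter, Pi.smul_apply, smul_eq_mul, mul_sub, Finset.mul_sum, mul_assoc]

lemma inter_sub_left (x y z : Pic) : inter (x - y) z = inter x z - inter y z := by
  simp only [inter, Pi.sub_apply, sub_mul, Finset.sum_sub_distrib]
  ring

lemma inter_add_right (x y z : Pic) : inter x (y + z) = inter x y + inter x z := by
  simp only [inter_comm x, inter_add_left]

lemma inter_smul_right (n : ℤ) (x z : Pic) : inter x (n • z) = n * inter x z := by
  simp only [inter_comm x, inter_smul_left]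

lemma inter_sub_right (x y z : Pic) : inter x (y - z) = inter x y - inter x z := by
  simp only [inter_comm x, inter_sub_left]

lemma inter_zero_left (x : Pic) : inter 0 x = 0 := by
  simp [inter]

lemma inter_sum_left {ι : Type*} (s : Finset ι) (f : ι → Pic) (x : Pic) :
    inter (∑ i ∈ s, f i) x = ∑ i ∈ s, inter (f i) x := by
  classical
  induction s using Finset.induction_on with
  | empty => simp [inter_zero_left]
  | insert a s ha ih => rw [Finset.sum_insert ha, Finset.sum_insert ha, inter_add_left, ih]

lemma inter_K_right (x : Pic) : inter x K = -3 * x 0 - ∑ i : Fin 8, x i.succ := by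
  simp [inter, K, mul_comm]

lemma inter_K_K : inter K K = 1 := by
  simp [inter, K]

/-- The canonical class is characteristic. -/
lemma two_dvd_inter_self_sub (x : Pic) : (2 : ℤ) ∣ inter x x - inter x K := by
  have h : inter x x - inter x K =
      x 0 * (x 0 + 1) + 2 * x 0 - ∑ i : Fin 8, x i.succ * (x i.succ - 1) := by
    rw [inter_K_right]
    simp only [mul_sub, mul_one, Finset.sum_sub_distrib, inter]
    ring
  rw [h]
  refine dvd_sub (dvd_add (Int.even_mul_succ_self _).two_dvd (dvd_mul_right _ _))
    (Finset.dvd_sum fun i _ => (Int.even_mul_pred_self _).two_dvd)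

lemma eight_mul_inter_self_le {x : Pic} (hx : inter x K = 0) : 8 * inter x x ≤ -(x 0) ^ 2 := by
  have h := sq_sum_le_card_mul_sum_sq (s := Finset.univ) (f := fun i : Fin 8 => x i.succ)
  rw [inter_K_right] at hx
  have hs : ∑ i : Fin 8, x i.succ = -3 * x 0 := by linarith
  rw [hs] at h
  simp only [Finset.card_univ, Fintype.card_fin, Nat.cast_ofNat] at h
  simp only [inter, ← sq]
  nlinarith

/-- The intersection pairing is negative semidefinite on `K^⊥`. -/
lemma inter_self_nonpos {x : Pic} (hx : inter x K = 0) : inter x x ≤ 0 := by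
  nlinarith [eight_mul_inter_self_le hx, sq_nonneg (x 0)]

/-- The intersection pairing is anisotropic on `K^⊥`. -/
lemma eq_zero_of_inter_self {x : Pic} (hx : inter x K = 0) (h : inter x x = 0) : x = 0 := by
  have h0 : x 0 = 0 := by
    have := eight_mul_inter_self_le hx
    have : (x 0) ^ 2 = 0 := le_antisymm (by linarith) (sq_nonneg _)
    exact pow_eq_zero_iff two_ne_zero |>.1 this
  have hs : ∑ i : Fin 8, x i.succ * x i.succ = 0 := by
    simpa [inter, h0] using h
  rw [Finset.sum_eq_zero_iff_of_nonneg fun i _ => mul_self_nonneg _] at hs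
  funext i
  refine Fin.cases h0 (fun j => ?_) i
  exact mul_self_eq_zero.1 (hs j (Finset.mem_univ j))

lemma IsLine.inter_bounds {l m : Pic} (hl : IsLine l) (hm : IsLine m) :
    -1 ≤ inter l m ∧ inter l m ≤ 3 := by
  obtain ⟨hl1, hl2⟩ := hl
  obtain ⟨hm1, hm2⟩ := hm
  have h1 : inter (l - m) (l - m) ≤ 0 := inter_self_nonpos (by rw [inter_sub_left]; omega)
  have h2 : inter (l + m + (2 : ℤ) • K) (l + m + (2 : ℤ) • K) ≤ 0 :=
    inter_self_nonpos (by simp only [inter_add_left, inter_smul_left, inter_K_K]; omega)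
  simp only [inter_add_left, inter_smul_left, inter_add_right, inter_smul_right, inter_K_K,
    inter_sub_left, inter_sub_right, inter_comm m l, inter_comm K] at h1 h2
  omega

lemma IsLine.eq_of_inter {l m : Pic} (hl : IsLine l) (hm : IsLine m) (h : inter l m = -1) :
    l = m := by
  obtain ⟨hl1, hl2⟩ := hl
  obtain ⟨hm1, hm2⟩ := hm
  refine sub_eq_zero.1 (eq_zero_of_inter_self (by rw [inter_sub_left]; omega) ?_)
  simp only [inter_sub_left, inter_sub_right, inter_comm m l]
  omega

/-- Lines meeting in `3` are exchanged by the Bertini involution. -/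
lemma IsLine.add_eq_of_inter {l m : Pic} (hl : IsLine l) (hm : IsLine m) (h : inter l m = 3) :
    l + m + (2 : ℤ) • K = 0 := by
  obtain ⟨hl1, hl2⟩ := hl
  obtain ⟨hm1, hm2⟩ := hm
  refine eq_zero_of_inter_self
    (by simp only [inter_add_left, inter_smul_left, inter_K_K]; omega) ?_
  simp only [inter_add_left, inter_smul_left, inter_add_right, inter_smul_right, inter_K_K,
    inter_comm m l, inter_comm K]
  omega

/-- Every class of self-intersection `3` modulo `4` is congruent to a line modulo `2`. -/
lemma exists_isLine_congr (y : Pic) (hy : inter y y % 4 = 3) :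
    ∃ m z : Pic, IsLine m ∧ m = y + (2 : ℤ) • z := by
  suffices h : ∃ m : Pic, IsLine m ∧ ∀ j, (2 : ℤ) ∣ m j - y j by
    obtain ⟨m, hm, hd⟩ := h
    choose z hz using hd
    refine ⟨m, z, hm, funext fun j => ?_⟩
    have := hz j
    simp only [Pi.add_apply, Pi.smul_apply, smul_eq_mul]
    omega
  set u : Fin 8 → ℤ := fun i => y i.succ % 2 with hu
  have hu01 : ∀ i, u i = 0 ∨ u i = 1 := fun i => Int.emod_two_eq_zero_or_one _
  have huu : ∀ i, u i * u i = u i := fun i => by rcases hu01 i with h | h <;> rw [h] <;> rfl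
  have sq_congr : ∀ a : ℤ, (4 : ℤ) ∣ a * a - a % 2 := fun a => by
    obtain ⟨b, rfl | rfl⟩ : ∃ b, a = 2 * b ∨ a = 2 * b + 1 := ⟨a / 2, by omega⟩
    · exact ⟨b * b, by rw [Int.mul_emod_right]; ring⟩
    · exact ⟨b * b + b, by rw [show (2 * b + 1) % 2 = 1 by omega]; ring⟩
  have hS : (4 : ℤ) ∣ ∑ i : Fin 8, y i.succ * y i.succ - ∑ i, u i := by
    rw [← Finset.sum_sub_distrib]
    exact Finset.dvd_sum fun i _ => sq_congr _
  have h0 := sq_congr (y 0)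
  have hSle : ∑ i, u i ≤ 8 := by
    simpa using Finset.sum_le_card_nsmul Finset.univ u 1 fun i _ => by
      rcases hu01 i with h | h <;> omega
  have hSnn : 0 ≤ ∑ i, u i := Finset.sum_nonneg fun i _ => by rcases hu01 i with h | h <;> omega
  have key : (y 0 % 2 = 0 ∧ (∑ i, u i = 1 ∨ ∑ i, u i = 5)) ∨
      (y 0 % 2 = 1 ∧ (∑ i, u i = 2 ∨ ∑ i, u i = 6)) := by
    simp only [inter] at hy
    omega
  have build : ∀ (d : ℤ) (v : Fin 8 → ℤ), d * d - ∑ i, v i * v i = -1 →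
      -3 * d - ∑ i, v i = -1 → (2 : ℤ) ∣ d - y 0 → (∀ i, (2 : ℤ) ∣ v i - u i) →
      ∃ m : Pic, IsLine m ∧ ∀ j, (2 : ℤ) ∣ m j - y j := by
    intro d v h1 h2 h3 h4
    refine ⟨Fin.cons d v, ⟨by simpa [inter] using h1, by simpa [inter_K_right] using h2⟩, ?_⟩
    refine Fin.cases (by simpa using h3) fun i => ?_
    have := h4 i
    simp only [hu] at this
    simp only [Fin.cons_succ]
    omega
  rcases key with ⟨hy0, h | h⟩ | ⟨hy0, h | h⟩
  · exact build 0 u (by simp [huu, h]) (by simp [h]) (by omega) (by simp)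
  · exact build 2 (fun i => -u i) (by simp [huu, h]) (by simp [h]) (by omega) (fun i => by omega)
  · exact build 1 (fun i => -u i) (by simp [huu, h]) (by simp [h]) (by omega) (fun i => by omega)
  · obtain ⟨k, hk⟩ : ∃ k, u k = 0 := by
      by_contra! hne
      have : ∀ i, u i = 1 := fun i => (hu01 i).resolve_left (hne i)
      simp [this] at h
    refine build 3 (fun i => -u i - 2 * if i = k then 1 else 0) ?_ ?_ (by omega)
      (fun i => by omega)
    · have hsq : ∀ i, (-u i - 2 * if i = k then 1 else 0) * (-u i - 2 * if i = k then 1 else 0)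
          = u i + 4 * if i = k then 1 else 0 := fun i => by
        split_ifs with hi
        · rw [hi, hk]; norm_num
        · linarith [huu i]
      simp only [hsq, Finset.sum_add_distrib, ← Finset.mul_sum, Finset.sum_ite_eq',
        Finset.mem_univ, if_true, h]
      norm_num
    · simp [Finset.sum_sub_distrib, h]

/-- Pairing with a family of classes independent modulo `2` realizes every parity pattern. -/
lemma exists_inter_parity {ι : Type*} [Fintype ι] (v : ι → Pic)
    (hv : ∀ (n : ι → ℤ) (z : Pic), (∀ i, n i = 0 ∨ n i = 1) →
      ∑ i, n i • v i = (2 : ℤ) • z → n = 0) (p : ι → ℤ) :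
    ∃ y : Pic, ∀ i, (2 : ℤ) ∣ inter y (v i) - p i := by
  let M : Matrix ι (Fin 9) (ZMod 2) := Matrix.of fun i j => (v i j : ZMod 2)
  have hcast : ∀ a : ZMod 2, ((a.val : ℤ) : ZMod 2) = a := fun a => by simp
  have hM : LinearIndependent (ZMod 2) M.row := by
    rw [Fintype.linearIndependent_iff]
    intro g hg
    have hd : ∀ j, (2 : ℤ) ∣ (∑ i, ((g i).val : ℤ) • v i) j := fun j => by
      rw [← Nat.cast_ofNat, ← ZMod.intCast_zmod_eq_zero_iff_dvd]
      have := congrFun hg j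
      simp only [Finset.sum_apply, Pi.smul_apply, smul_eq_mul, Int.cast_sum, Int.cast_mul, hcast]
      simpa [M, Finset.sum_apply] using this
    choose z hz using hd
    have h0 := hv (fun i => ((g i).val : ℤ)) z (fun i => by
      have := ZMod.val_lt (g i)
      omega) (funext fun j => by simpa using hz j)
    intro i
    rw [← hcast (g i), congrFun h0 i]
    simp
  have hsurj : Function.Surjective M.mulVec := by
    refine LinearMap.range_eq_top.1 (Submodule.eq_top_of_finrank_eq (?_ :
      Module.finrank (ZMod 2) (LinearMap.range M.mulVecLin) = _))
    rw [Module.finrank_fintype_fun_eq_card]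
    exact hM.rank_matrix
  obtain ⟨w, hw⟩ := hsurj fun i => (p i : ZMod 2)
  refine ⟨fun j => ((w j).val : ℤ), fun i => ?_⟩
  rw [← Nat.cast_ofNat, ← ZMod.intCast_zmod_eq_zero_iff_dvd]
  have := congrFun hw i
  simp only [Matrix.mulVec, dotProduct, M, Matrix.of_apply, Fin.sum_univ_succ (n := 8)] at this
  simp only [inter, Int.cast_sub, Int.cast_mul, Int.cast_sum, hcast, ← this, CharTwo.sub_eq_add,
    mul_comm]
  exact CharTwo.add_self_eq_zero _

/-- In an uncornered polytope, the four lines and `K` are independent modulo `2`. -/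
lemma eq_zero_of_sum_eq_two_smul (l : Fin 4 → Pic) (hline : ∀ i, IsLine (l i))
    (hint : ∀ i j, i ≠ j → inter (l i) (l j) = 1)
    (huncor : ¬ ∃ m : Pic, IsLine m ∧ ∀ i, inter m (l i) = 0)
    (n : Option (Fin 4) → ℤ) (z : Pic) (hn : ∀ i, n i = 0 ∨ n i = 1)
    (hz : ∑ i, n i • (i.elim K l : Pic) = (2 : ℤ) • z) : n = 0 := by
  have hK : ∀ i, inter (l i) K = -1 := fun i => (hline i).2
  have hpair : ∀ i j, inter (l i) (l j) = if i = j then -1 else 1 := fun i j => by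
    split_ifs with h
    · rw [← h, (hline i).1]
    · exact hint i j h
  rw [Fintype.sum_option, Fin.sum_univ_four] at hz
  simp only [Option.elim] at hz
  have hzl : ∀ x, 2 * inter z x = n none * inter x K + (n (some 0) * inter (l 0) x +
      n (some 1) * inter (l 1) x + n (some 2) * inter (l 2) x + n (some 3) * inter (l 3) x) := by
    intro x
    rw [← inter_smul_left, ← hz]
    simp only [inter_add_left, inter_smul_left, inter_comm K]
  have h0 := hzl (l 0)
  have h1 := hzl (l 1)
  have h2 := hzl (l 2)
  have h3 := hzl (l 3)
  have hk := hzl K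
  have hzz := hzl z
  simp only [inter_comm _ z] at hzz
  simp only [hpair, hK, inter_K_K] at h0 h1 h2 h3 hk
  have hpar := two_dvd_inter_self_sub z
  have hcorner : ¬ (inter z z = 2 ∧ inter z K = -2 ∧ inter z (l 0) = 1 ∧ inter z (l 1) = 1 ∧
      inter z (l 2) = 1 ∧ inter z (l 3) = 1) := by
    rintro ⟨ha, hb, hc⟩
    refine huncor ⟨z + K, ⟨?_, ?_⟩, fun i => ?_⟩
    · simp only [inter_add_left, inter_add_right, inter_comm K z, inter_K_K]
      omega
    · simp only [inter_add_left, inter_K_K]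
      omega
    · rw [inter_add_left, inter_comm K, hK]
      fin_cases i <;> simp [hc]
  suffices h : n none = 0 ∧ n (some 0) = 0 ∧ n (some 1) = 0 ∧ n (some 2) = 0 ∧
      n (some 3) = 0 by
    funext i
    rcases i with _ | i
    · exact h.1
    · fin_cases i <;> simp [h]
  rcases hn none with e | e <;> rcases hn (some 0) with e0 | e0 <;>
    rcases hn (some 1) with e1 | e1 <;> rcases hn (some 2) with e2 | e2 <;>
    rcases hn (some 3) with e3 | e3 <;>
    simp [e, e0, e1, e2, e3] at h0 h1 h2 h3 hk hzz ⊢ <;> omega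

/-- Adding the roots `lᵢ + K` turns intersection numbers `2` into `0`. -/
lemma exists_isLine_inter_eq_zero {ι : Type*} [DecidableEq ι] (l : ι → Pic)
    (hline : ∀ i, IsLine (l i)) (hint : ∀ i j, i ≠ j → inter (l i) (l j) = 1)
    {m : Pic} (hm : IsLine m) (s : Finset ι) (hs : ∀ i ∈ s, inter m (l i) = 0 ∨ inter m (l i) = 2) :
    ∃ m' : Pic, IsLine m' ∧ (∀ i ∈ s, inter m' (l i) = 0) ∧
      ∀ i ∉ s, inter m' (l i) = inter m (l i) := by
  induction s using Finset.induction_on with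
  | empty => exact ⟨m, hm, by simp, by simp⟩
  | insert a s ha ih =>
    obtain ⟨m', hm', hz, hr⟩ := ih fun i hi => hs i (Finset.mem_insert_of_mem hi)
    have hKl : ∀ i, inter K (l i) = -1 := fun i => by rw [inter_comm, (hline i).2]
    rcases hs a (Finset.mem_insert_self a s) with h | h
    · refine ⟨m', hm', fun i hi => ?_, fun i hi => hr i fun h' =>
        hi (Finset.mem_insert_of_mem h')⟩
      rcases Finset.mem_insert.1 hi with rfl | hi
      · rw [hr _ ha, h]
      · exact hz i hi
    · have hother : ∀ i, i ≠ a → inter (m' + l a + K) (l i) = inter m' (l i) := fun i hi => by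
        simp only [inter_add_left, hint a i hi.symm, hKl]
        ring
      have hma := hr a ha
      refine ⟨m' + l a + K, ⟨?_, ?_⟩, fun i hi => ?_, fun i hi => ?_⟩
      · simp only [inter_add_left, inter_add_right, inter_comm K, inter_comm (l a) m',
          inter_K_K, hma, h, hm'.1, hm'.2, (hline a).1, (hline a).2]
        norm_num
      · simp only [inter_add_left, inter_K_K, hm'.2, (hline a).2]
        norm_num
      · by_cases hia : i = a
        · subst hia
          simp only [inter_add_left, hma, h, (hline _).1, hKl]
          norm_num
        · rw [hother i hia, hz i (Finset.mem_of_mem_insert_of_ne hi hia)]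
      · rw [Finset.mem_insert, not_or] at hi
        rw [hother i hi.1, hr i hi.2]

/-- For each facet of an uncornered polytope there is a line disjoint from that facet and meeting
the opposite vertex once. -/
lemma exists_isLine_of_facet (l : Fin 4 → Pic) (hline : ∀ i, IsLine (l i))
    (hint : ∀ i j, i ≠ j → inter (l i) (l j) = 1)
    (huncor : ¬ ∃ m : Pic, IsLine m ∧ ∀ i, inter m (l i) = 0) (t : Fin 4) :
    ∃ m : Pic, IsLine m ∧ (∀ s, s ≠ t → inter m (l s) = 0) ∧ inter m (l t) = 1 := by
  obtain ⟨y, hy⟩ := exists_inter_parity (fun i : Option (Fin 4) => (i.elim K l : Pic))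
    (eq_zero_of_sum_eq_two_smul l hline hint huncor)
    (fun i => i.elim 1 fun s => if s = t then 1 else 0)
  have hKl : ∀ i, inter K (l i) = -1 := fun i => by rw [inter_comm, (hline i).2]
  have hyK : (2 : ℤ) ∣ inter y K - 1 := hy none
  have hyt : (2 : ℤ) ∣ inter y (l t) - 1 := by simpa using hy (some t)
  have hys : ∀ s, s ≠ t → (2 : ℤ) ∣ inter y (l s) := fun s hs => by simpa [hs] using hy (some s)
  obtain ⟨y', hyy, hyt', hys'⟩ : ∃ y' : Pic, inter y' y' % 4 = 3 ∧ (2 : ℤ) ∣ inter y' (l t) - 1 ∧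
      ∀ s, s ≠ t → (2 : ℤ) ∣ inter y' (l s) := by
    have hchar := two_dvd_inter_self_sub y
    by_cases h3 : inter y y % 4 = 3
    · exact ⟨y, h3, hyt, hys⟩
    · refine ⟨y + l t + K, ?_, ?_, fun s hs => ?_⟩
      · simp only [inter_add_left, inter_add_right, inter_comm K, inter_comm (l t) y,
          inter_K_K, (hline t).1, (hline t).2]
        omega
      · simp only [inter_add_left, (hline t).1, hKl]
        omega
      · have := hys s hs
        simp only [inter_add_left, hint t s hs.symm, hKl]
        omega
  obtain ⟨m, z, hm, hmz⟩ := exists_isLine_congr y' hyy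
  have hmi : ∀ x, inter m x = inter y' x + 2 * inter z x := fun x => by
    rw [hmz, inter_add_left, inter_smul_left]
  have hmt : (2 : ℤ) ∣ inter m (l t) - 1 := by rw [hmi]; omega
  have hms : ∀ s, s ≠ t → (2 : ℤ) ∣ inter m (l s) := fun s hs => by
    have := hys' s hs
    rw [hmi]; omega
  obtain ⟨s₀, hs₀⟩ := exists_ne t
  have hm1 : inter m (l t) = 1 := by
    have hb := hm.inter_bounds (hline t)
    have hs := hms s₀ hs₀
    have h1 : inter m (l t) ≠ -1 := fun h => by
      rw [hm.eq_of_inter (hline t) h, hint t s₀ hs₀.symm] at hs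
      omega
    have h2 : inter m (l t) ≠ 3 := fun h => by
      have := congrArg (inter · (l s₀)) (hm.add_eq_of_inter (hline t) h)
      simp only [inter_add_left, inter_smul_left, inter_zero_left, hKl,
        hint t s₀ hs₀.symm] at this
      omega
    omega
  obtain ⟨m', hm', hz, hr⟩ := exists_isLine_inter_eq_zero l hline hint hm (Finset.univ.erase t)
    fun s hs => by
      have hst := Finset.ne_of_mem_erase hs
      have := hms s hst
      have := hm.inter_bounds (hline s)
      omega
  exact ⟨m', hm', fun s hs => hz s (by simpa using hs), by rw [hr t (by simp), hm1]⟩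

theorem uncornered_gives_four_skew_edges (l : Fin 4 → Pic)
    (hinj : Function.Injective l)
    (hline : ∀ i, IsLine (l i))
    (hint : ∀ i j, i ≠ j → inter (l i) (l j) = 1)
    (huncor : ¬ ∃ m : Pic, IsLine m ∧ ∀ i, inter m (l i) = 0) :
    -- for the triple omitting index `t`, the two lines are `la t` and `lb t`
    ∃ la lb : Fin 4 → Pic,
      (∀ t, IsLine (la t) ∧ IsLine (lb t) ∧ inter (la t) (lb t) = 0 ∧
        la t + lb t = (∑ i, l i) - l t + K ∧
        (∀ s, s ≠ t → inter (la t) (l s) = 0 ∧ inter (lb t) (l s) = 0) ∧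
        inter (la t) (l t) = 1 ∧ inter (lb t) (l t) = 1) ∧
      Function.Injective (fun p : Fin 4 × Bool => if p.2 then la p.1 else lb p.1) ∧
      (∀ p q : Fin 4 × Bool, p ≠ q →
        inter (if p.2 then la p.1 else lb p.1) (if q.2 then la q.1 else lb q.1) = 0) ∧
      (∑ t, (la t + lb t)) = 3 • (∑ i, l i) + 4 • K := by
  choose la hla hla0 hla1 using exists_isLine_of_facet l hline hint huncor
  have hK : ∀ i, inter (l i) K = -1 := fun i => (hline i).2
  have hKl : ∀ i, inter K (l i) = -1 := fun i => by rw [inter_comm, hK]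
  have hpair : ∀ i j, inter (l i) (l j) = if i = j then -1 else 1 := fun i j => by
    split_ifs with h
    · rw [← h, (hline i).1]
    · exact hint i j h
  have hlal : ∀ t s, inter (la t) (l s) = if s = t then 1 else 0 := fun t s => by
    split_ifs with h
    · rw [h, hla1]
    · exact hla0 t s h
  set c : Fin 4 → Pic := fun t => (∑ i, l i) - l t + K with hc
  have hcl : ∀ t s, inter (c t) (l s) = if s = t then 2 else 0 := fun t s => by
    simp only [hc, inter_add_left, inter_sub_left, Fin.sum_univ_four, hpair, hKl]
    fin_cases t <;> fin_cases s <;> rfl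
  have hcK : ∀ t, inter (c t) K = -2 := fun t => by
    simp [hc, inter_add_left, inter_sub_left, inter_sum_left, hK, inter_K_K]
  have hcx : ∀ t x, inter x (c t) = ∑ i, inter x (l i) - inter x (l t) + inter x K :=
    fun t x => by
      simp only [hc, inter_comm x, inter_add_left, inter_sub_left, inter_sum_left]
  have hcc : ∀ t, inter (c t) (c t) = -2 := fun t => by
    simp [hcx, hcl, hcK]
  have hac : ∀ t u, inter (la t) (c u) = if t = u then -1 else 0 := fun t u => by
    simp only [hcx, hlal, (hla t).2, Finset.sum_ite_eq', Finset.mem_univ, if_true, eq_comm (a := u)]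
    split_ifs <;> rfl
  have hca : ∀ t u, inter (c t) (la u) = if u = t then -1 else 0 := fun t u => by
    rw [inter_comm, hac]
  have hccne : ∀ t u, t ≠ u → inter (c t) (c u) = 0 := fun t u h => by
    simp [hcx, hcl, hcK, h.symm]
  have haa : ∀ t u, t ≠ u → inter (la t) (la u) = 0 := fun t u h => by
    have hw : ∀ n : ℤ, inter ((2 : ℤ) • la t - c t + n • ((2 : ℤ) • la u - c u))
        ((2 : ℤ) • la t - c t + n • ((2 : ℤ) • la u - c u)) ≤ 0 := fun n =>
      inter_self_nonpos (by
        simp only [inter_add_left, inter_sub_left, inter_smul_left, hcK, (hla _).2]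
        ring)
    have h1 := hw 1
    have h2 := hw (-1)
    simp only [inter_add_left, inter_sub_left, inter_smul_left, inter_add_right, inter_sub_right,
      inter_smul_right, hac, hca, hcc, (hla _).1, hccne t u h, hccne u t h.symm, h, h.symm,
      inter_comm (la u) (la t), if_true, if_false] at h1 h2
    omega
  set f : Fin 4 × Bool → Pic := fun p => if p.2 then la p.1 else c p.1 - la p.1 with hf
  have hself : ∀ p, inter (f p) (f p) = -1 := by
    rintro ⟨t, _ | _⟩
    · simp [hf, inter_sub_left, inter_sub_right, hac, hca, hcc, (hla t).1]
    · simp [hf, (hla t).1]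
  have hskew : ∀ p q, p ≠ q → inter (f p) (f q) = 0 := by
    rintro ⟨t, b⟩ ⟨u, b'⟩ hne
    by_cases htu : t = u
    · subst htu
      cases b <;> cases b' <;> simp only [ne_eq, not_true_eq_false] at hne <;>
        simp [hf, inter_sub_left, inter_sub_right, hac, hca, (hla _).1]
    · cases b <;> cases b' <;>
        simp [hf, inter_sub_left, inter_sub_right, hac, hca, haa t u htu, hccne t u htu, htu,
          Ne.symm htu]
  refine ⟨la, fun t => c t - la t, fun t => ⟨hla t, ⟨hself (t, false), ?_⟩,
    hskew (t, true) (t, false) (by simp), add_sub_cancel _ _, fun s hs => ⟨hla0 t s hs, ?_⟩,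
    hla1 t, ?_⟩, fun p q hpq => ?_, hskew, ?_⟩
  · rw [inter_sub_left, hcK, (hla t).2]
    norm_num
  · simp [inter_sub_left, hcl, hlal, hs]
  · simp [inter_sub_left, hcl, hlal]
  · by_contra hne
    have h0 := hskew p q hne
    rw [show f p = f q from hpq, hself] at h0
    omega
  · simp only [add_sub_cancel, hc, Fin.sum_univ_four]
    abel

end DelPezzo
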